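/- There is a universal constant a > 0 such that for every N ≥ 2 and every total Boolean function f : {0,1}^N → {0,1}, the cheat sheet version f_CS satisfies C_0(f_CS) ≤ a · C(f) · (log₂ N)². -/

import Mathlib

/-! ### Partial assignments and certificate complexity -/

/-- An input `x` is consistent with a partial assignment `p` if it agrees with
`p` wherever `p` is defined. -/
def Consistent {n : ℕ} (x : Fin n → Bool) (p : Fin n → Option Bool) : Prop :=
  ∀ i : Fin n, ∀ b : Bool, p i = some b → x i = b

instance {n : ℕ} (x : Fin n → Bool) (p : Fin n → Option Bool) :
    Decidable (Consistent x p) := by unfold Consistent; infer_instance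

/-- The width of a partial assignment: the number of fixed coordinates. -/
def paWidth {n : ℕ} (p : Fin n → Option Bool) : ℕ :=
  (Finset.univ.filter (fun i : Fin n => (p i).isSome)).card

/-- `p` is a `b`-certificate for `f`: every input consistent with `p` has value `b`. -/
def IsCert {n : ℕ} (f : (Fin n → Bool) → Bool) (b : Bool) (p : Fin n → Option Bool) : Prop :=
  ∀ x : Fin n → Bool, Consistent x p → f x = b

instance {n : ℕ} (f : (Fin n → Bool) → Bool) (b : Bool) (p : Fin n → Option Bool) :
    Decidable (IsCert f b p) := by unfold IsCert; infer_instance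

/-- The `b`-certificate complexity `C_b(f)`. -/
noncomputable def certC {n : ℕ} (f : (Fin n → Bool) → Bool) (b : Bool) : ℕ :=
  sInf {w : ℕ | ∀ x : Fin n → Bool, f x = b →
    ∃ p : Fin n → Option Bool, IsCert f b p ∧ paWidth p ≤ w ∧ Consistent x p}

/-- The certificate complexity `C(f) = max{C_0(f), C_1(f)}`. -/
noncomputable def certCC {n : ℕ} (f : (Fin n → Bool) → Bool) : ℕ :=
  max (certC f false) (certC f true)

/-- The unambiguous `b`-certificate complexity `UC_b(f)`. -/
noncomputable def UCb {n : ℕ} (f : (Fin n → Bool) → Bool) (b : Bool) : ℕ :=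
  sInf {w : ℕ | ∃ S : Set (Fin n → Option Bool),
    (∀ p ∈ S, IsCert f b p ∧ paWidth p ≤ w) ∧
    ∀ x : Fin n → Bool, f x = b → ∃! p, p ∈ S ∧ Consistent x p}

/-- Subcube partition complexity `UC(f) = max{UC_0(f), UC_1(f)}`. -/
noncomputable def UC {n : ℕ} (f : (Fin n → Bool) → Bool) : ℕ :=
  max (UCb f false) (UCb f true)

/-! ### The cheat sheet construction -/

/-- Interpret `g 0, …, g (L-1)` as the binary representation of a number. -/
def bitsToNat (L : ℕ) (g : ℕ → Bool) : ℕ :=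
  ∑ t ∈ Finset.range L, if g t then 2 ^ t else 0

/-- Read position `p` of the cell `Y` (`0` when the cell is empty). -/
def cellBit {m : ℕ} (Y : Fin m → Bool) (p : ℕ) : Bool :=
  if h : p % m < m then Y ⟨p % m, h⟩ else false

/-- Decode the `i`-th partial assignment stored in the cell `Y`: it is given by
`Cf` pairs, each consisting of an index (written in `L` bits) and a value bit. -/
def decodePA (N L Cf : ℕ) {m : ℕ} (Y : Fin m → Bool) (i : ℕ) : Fin N → Option Bool :=
  fun j =>
    ((List.range Cf).find? (fun t =>
        bitsToNat L (fun s => cellBit Y ((i * Cf + t) * (L + 1) + s)) == (j : ℕ))).map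
      (fun t => cellBit Y ((i * Cf + t) * (L + 1) + L))

/-- The cheat sheet version of `f`, on its natural (structured) input domain:
`c` inputs to `f` together with `2^c` cells of `m` bits each. -/
noncomputable def cheatSheetAux {N : ℕ} (f : (Fin N → Bool) → Bool) :
    ((Fin (10 * Nat.clog 2 N) × Fin N) ⊕
      (Fin (2 ^ (10 * Nat.clog 2 N)) × Fin (10 * certCC f * (Nat.clog 2 N) ^ 2)) → Bool)
    → Bool :=
  fun z =>
    let c := 10 * Nat.clog 2 N
    let x : Fin c → (Fin N → Bool) := fun i j => z (Sum.inl (i, j))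
    let ℓb : Fin c → Bool := fun i => f (x i)
    let ℓ : ℕ := ∑ i : Fin c, if ℓb i then 2 ^ (c - 1 - (i : ℕ)) else 0
    let Y : Fin (10 * certCC f * (Nat.clog 2 N) ^ 2) → Bool :=
      fun j => z (Sum.inr (⟨ℓ % 2 ^ c, Nat.mod_lt _ (by positivity)⟩, j))
    decide (∀ i : Fin c,
      Consistent (x i) (decodePA N (Nat.clog 2 N) (certCC f) Y (i : ℕ)) ∧
      IsCert f (ℓb i) (decodePA N (Nat.clog 2 N) (certCC f) Y (i : ℕ)))

/-- Number of input bits of the cheat sheet version of an `N`-bit function with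
certificate complexity `Cf`. -/
def csCard (N Cf : ℕ) : ℕ :=
  10 * Nat.clog 2 N * N + 2 ^ (10 * Nat.clog 2 N) * (10 * Cf * (Nat.clog 2 N) ^ 2)

/-- Relabelling of the structured cheat sheet domain as a set of `csCard N Cf` bits. -/
def csIndex (N Cf : ℕ) :
    (Fin (10 * Nat.clog 2 N) × Fin N) ⊕
      (Fin (2 ^ (10 * Nat.clog 2 N)) × Fin (10 * Cf * (Nat.clog 2 N) ^ 2))
    ≃ Fin (csCard N Cf) :=
  (Equiv.sumCongr finProdFinEquiv finProdFinEquiv).trans finSumFinEquiv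

/-- The cheat sheet version `f_CS` of `f`, as a total Boolean function on
`csCard N (C f)` bits. -/
noncomputable def cheatSheet {N : ℕ} (f : (Fin N → Bool) → Bool) :
    (Fin (csCard N (certCC f)) → Bool) → Bool :=
  fun z => cheatSheetAux f (fun u => z (csIndex N (certCC f) u))

/-- Fixing the coordinates of `x` in `T` determines the value of `f`. -/
def Determines {ι : Type*} (f : (ι → Bool) → Bool) (x : ι → Bool) (T : Finset ι) : Prop :=
  ∀ y : ι → Bool, (∀ i ∈ T, y i = x i) → f y = f x

/-- The partial assignment that fixes the coordinates in `T` to their values in `x`. -/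
def restrictTo {n : ℕ} (x : Fin n → Bool) (T : Finset (Fin n)) : Fin n → Option Bool :=
  fun i => if i ∈ T then some (x i) else none

theorem consistent_restrictTo {n : ℕ} (x y : Fin n → Bool) (T : Finset (Fin n)) :
    Consistent y (restrictTo x T) ↔ ∀ i ∈ T, y i = x i := by
  simp [Consistent, restrictTo]

theorem paWidth_restrictTo {n : ℕ} (x : Fin n → Bool) (T : Finset (Fin n)) :
    paWidth (restrictTo x T) = T.card := by
  unfold paWidth restrictTo
  congr 1
  ext i
  by_cases h : i ∈ T <;> simp [h]

theorem certC_le_of_determines {n : ℕ} {f : (Fin n → Bool) → Bool} {b : Bool} {w : ℕ}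
    (h : ∀ x, f x = b → ∃ T : Finset (Fin n), T.card ≤ w ∧ Determines f x T) :
    certC f b ≤ w := by
  refine Nat.sInf_le fun x hx => ?_
  obtain ⟨T, hT, hd⟩ := h x hx
  refine ⟨restrictTo x T, fun y hy => ?_, (paWidth_restrictTo x T).trans_le hT, ?_⟩
  · rw [hd y ((consistent_restrictTo x y T).1 hy), hx]
  · exact (consistent_restrictTo x x T).2 fun _ _ => rfl

theorem exists_determines_card_le_certC {n : ℕ} (f : (Fin n → Bool) → Bool) (x : Fin n → Bool) :
    ∃ T : Finset (Fin n), T.card ≤ certC f (f x) ∧ Determines f x T := by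
  have hne : {w : ℕ | ∀ y : Fin n → Bool, f y = f x →
      ∃ p : Fin n → Option Bool, IsCert f (f x) p ∧ paWidth p ≤ w ∧ Consistent y p}.Nonempty := by
    refine ⟨n, fun y hy => ⟨restrictTo y Finset.univ, fun z hz => ?_, ?_, ?_⟩⟩
    · rw [consistent_restrictTo] at hz
      rw [← hy, funext fun i => hz i (Finset.mem_univ i)]
    · simp [paWidth_restrictTo]
    · exact (consistent_restrictTo y y _).2 fun _ _ => rfl
  obtain ⟨p, hp, hw, hc⟩ := Nat.sInf_mem hne x rfl
  refine ⟨Finset.univ.filter fun i => (p i).isSome, hw, fun y hy => hp y fun i b hb => ?_⟩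
  rw [hy i (by simp [hb]), hc i b hb]

theorem exists_determines_card_le_certCC {n : ℕ} (f : (Fin n → Bool) → Bool) (x : Fin n → Bool) :
    ∃ T : Finset (Fin n), T.card ≤ certCC f ∧ Determines f x T := by
  obtain ⟨T, hT, hd⟩ := exists_determines_card_le_certC f x
  refine ⟨T, hT.trans ?_, hd⟩
  unfold certCC
  cases f x
  · exact le_max_left _ _
  · exact le_max_right _ _

theorem pos_of_decodePA_eq_some {N L C m i : ℕ} {Y : Fin m → Bool} {j : Fin N} {b : Bool}
    (h : decodePA N L C Y i j = some b) : 0 < C := by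
  rcases Nat.eq_zero_or_pos C with rfl | hC
  · simp [decodePA] at h
  · exact hC

/-- The number of the cell that is selected by the values `v`. -/
def cellAddress {c : ℕ} (v : Fin c → Bool) : Fin (2 ^ c) :=
  ⟨(∑ i : Fin c, if v i then 2 ^ (c - 1 - (i : ℕ)) else 0) % 2 ^ c,
    Nat.mod_lt _ (by positivity)⟩

theorem cheatSheetAux_eq_false_iff {N : ℕ} (f : (Fin N → Bool) → Bool)
    (z : (Fin (10 * Nat.clog 2 N) × Fin N) ⊕
      (Fin (2 ^ (10 * Nat.clog 2 N)) × Fin (10 * certCC f * (Nat.clog 2 N) ^ 2)) → Bool)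
    (v : Fin (10 * Nat.clog 2 N) → Bool) (hv : ∀ i, f (fun j => z (Sum.inl (i, j))) = v i)
    (Y : Fin (10 * certCC f * (Nat.clog 2 N) ^ 2) → Bool)
    (hY : ∀ j, z (Sum.inr (cellAddress v, j)) = Y j) :
    cheatSheetAux f z = false ↔ ∃ i : Fin (10 * Nat.clog 2 N),
      ¬ (Consistent (fun j => z (Sum.inl (i, j)))
          (decodePA N (Nat.clog 2 N) (certCC f) Y (i : ℕ)) ∧
        IsCert f (v i) (decodePA N (Nat.clog 2 N) (certCC f) Y (i : ℕ))) := by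
  obtain rfl : (fun i => f (fun j => z (Sum.inl (i, j)))) = v := funext hv
  obtain rfl : (fun j => z (Sum.inr (cellAddress _, j))) = Y := funext hY
  rw [← not_forall]
  exact decide_eq_false_iff_not

theorem exists_determines_cheatSheetAux {N : ℕ} (f : (Fin N → Bool) → Bool)
    (z : (Fin (10 * Nat.clog 2 N) × Fin N) ⊕
      (Fin (2 ^ (10 * Nat.clog 2 N)) × Fin (10 * certCC f * (Nat.clog 2 N) ^ 2)) → Bool)
    (hz : cheatSheetAux f z = false) :
    ∃ T : Finset _, T.card ≤ 10 * Nat.clog 2 N * certCC f + certCC f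
      + 10 * certCC f * (Nat.clog 2 N) ^ 2 ∧ Determines (cheatSheetAux f) z T := by
  classical
  let v : Fin (10 * Nat.clog 2 N) → Bool := fun i => f (fun j => z (Sum.inl (i, j)))
  let Y : Fin (10 * certCC f * (Nat.clog 2 N) ^ 2) → Bool :=
    fun j => z (Sum.inr (cellAddress v, j))
  choose S hS hSd using fun i : Fin (10 * Nat.clog 2 N) =>
    exists_determines_card_le_certCC f (fun j => z (Sum.inl (i, j)))
  obtain ⟨i, hi⟩ := (cheatSheetAux_eq_false_iff f z v (fun _ => rfl) Y (fun _ => rfl)).1 hz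
  -- The coordinates in `E` witness that the `i`-th stored assignment is refused.
  obtain ⟨E, hE, hEd⟩ : ∃ E : Finset (Fin N), E.card ≤ certCC f ∧
      ∀ y : Fin N → Bool, (∀ j ∈ E, y j = z (Sum.inl (i, j))) →
        ¬ (Consistent y (decodePA N (Nat.clog 2 N) (certCC f) Y (i : ℕ)) ∧
          IsCert f (v i) (decodePA N (Nat.clog 2 N) (certCC f) Y (i : ℕ))) := by
    by_cases hcert : IsCert f (v i) (decodePA N (Nat.clog 2 N) (certCC f) Y (i : ℕ))
    · have hcons : ¬ Consistent _ _ := fun h => hi ⟨h, hcert⟩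
      simp only [Consistent, not_forall] at hcons
      obtain ⟨j, b, hj, hne⟩ := hcons
      refine ⟨{j}, ?_, fun y hy h => hne ?_⟩
      · exact (Finset.card_singleton j).trans_le (pos_of_decodePA_eq_some hj)
      · rw [← hy j (by simp), h.1 j b hj]
    · exact ⟨∅, by simp, fun _ _ h => hcert h.2⟩
  refine ⟨((Finset.univ.sigma S).image (fun u => Sum.inl (u.1, u.2)) ∪
    E.image (fun j => Sum.inl (i, j))) ∪
    Finset.univ.image (fun j => Sum.inr (cellAddress v, j)), ?_, fun y hy => ?_⟩
  · refine (Finset.card_union_le _ _).trans (add_le_add ((Finset.card_union_le _ _).trans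
      (add_le_add (Finset.card_image_le.trans ?_) (Finset.card_image_le.trans hE)))
      (Finset.card_image_le.trans (by simp)))
    rw [Finset.card_sigma]
    simpa using Finset.sum_le_card_nsmul Finset.univ (fun i => (S i).card) _ fun i _ => hS i
  · have hyS : ∀ i, ∀ j ∈ S i, y (Sum.inl (i, j)) = z (Sum.inl (i, j)) := fun i j hj =>
      hy _ (by simp [hj])
    have hyE : ∀ j ∈ E, y (Sum.inl (i, j)) = z (Sum.inl (i, j)) := fun j hj =>
      hy _ (by simp [hj])
    have hyY : ∀ j, y (Sum.inr (cellAddress v, j)) = Y j := fun j => hy _ (by simp)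
    rw [hz, cheatSheetAux_eq_false_iff f y v (fun i => hSd i _ (hyS i)) Y hyY]
    exact ⟨i, hEd _ hyE⟩

theorem certC_cheatSheet_false_le {N : ℕ} (f : (Fin N → Bool) → Bool) :
    certC (cheatSheet f) false ≤ 10 * Nat.clog 2 N * certCC f + certCC f
      + 10 * certCC f * (Nat.clog 2 N) ^ 2 := by
  refine certC_le_of_determines fun x hx => ?_
  obtain ⟨T, hT, hd⟩ := exists_determines_cheatSheetAux f _ hx
  refine ⟨T.map (csIndex N (certCC f)).toEmbedding, by rwa [Finset.card_map], fun y hy => ?_⟩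
  exact hd _ fun u hu => hy _ (Finset.mem_map_of_mem _ hu)

theorem clog_le_two_mul_logb {N : ℕ} (hN : 2 ≤ N) :
    (Nat.clog 2 N : ℝ) ≤ 2 * Real.logb 2 N := by
  have h1 : (1 : ℝ) ≤ Real.logb 2 N := by
    rw [Real.le_logb_iff_rpow_le one_lt_two (by positivity)]
    simpa using (by exact_mod_cast hN : (2 : ℝ) ≤ N)
  have h2 : (Nat.clog 2 N : ℝ) < Real.logb 2 N + 1 := by
    have := Real.natCeil_logb_natCast 2 N
    push_cast at this
    rw [← this]
    exact Nat.ceil_lt_add_one (by linarith)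
  linarith

theorem stmt13 :
    ∃ a : ℝ, 0 < a ∧ ∀ N : ℕ, 2 ≤ N → ∀ f : (Fin N → Bool) → Bool,
      (certC (cheatSheet f) false : ℝ) ≤ a * certCC f * Real.logb 2 N ^ 2 := by
  refine ⟨84, by norm_num, fun N hN f => ?_⟩
  have hL : (1 : ℝ) ≤ Nat.clog 2 N := by exact_mod_cast Nat.clog_pos one_lt_two hN
  have hlog := clog_le_two_mul_logb hN
  have hle : (certC (cheatSheet f) false : ℝ) ≤ 10 * Nat.clog 2 N * certCC f + certCC f
      + 10 * certCC f * (Nat.clog 2 N : ℝ) ^ 2 := by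
    exact_mod_cast certC_cheatSheet_false_le f
  have hC : (0 : ℝ) ≤ certCC f := Nat.cast_nonneg _
  generalize (Nat.clog 2 N : ℝ) = L at *
  have hpoly : 10 * L + 1 + 10 * L ^ 2 ≤ 84 * Real.logb 2 N ^ 2 := by nlinarith
  calc (certC (cheatSheet f) false : ℝ)
      ≤ certCC f * (10 * L + 1 + 10 * L ^ 2) := by linarith
    _ ≤ certCC f * (84 * Real.logb 2 N ^ 2) := mul_le_mul_of_nonneg_left hpoly hC
    _ = 84 * certCC f * Real.logb 2 N ^ 2 := by ring
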